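/- Let G be a finite simple graph with maximum degree Δ(G) = 4. If mad(G) < 14/5, then the injective chromatic number of G satisfies χ_i(G) ≤ 6. -/

import Mathlib

open SimpleGraph

/-- An injective coloring of `G`: any two distinct vertices with a common neighbor
receive distinct colors. -/
def IsInjColoring {V α : Type*} (G : SimpleGraph V) (c : V → α) : Prop :=
  ∀ ⦃u v : V⦄, u ≠ v → (∃ w, G.Adj u w ∧ G.Adj v w) → c u ≠ c v

/-- The injective chromatic number of `G`: the least `k` such that `G` has an
injective coloring with `k` colors. -/
noncomputable def injChromNum {V : Type*} (G : SimpleGraph V) : ℕ :=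
  sInf {k | ∃ c : V → Fin k, IsInjColoring G c}

section

open scoped Classical

/-- Distinct vertices are adjacent when they have a common neighbor in `G`. -/
def conflictGraph {V : Type*} (G : SimpleGraph V) : SimpleGraph V where
  Adj u v := u ≠ v ∧ ∃ w, G.Adj u w ∧ G.Adj v w
  symm := ⟨fun _ _ ⟨h, w, hu, hv⟩ => ⟨h.symm, w, hv, hu⟩⟩
  loopless := ⟨fun _ h => h.1 rfl⟩

/-- `c` is a proper coloring of `K` outside the set `X`. -/
def ProperOff {V α : Type*} (K : SimpleGraph V) (X : Set V) (c : V → α) : Prop :=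
  ∀ ⦃a b : V⦄, a ∉ X → b ∉ X → K.Adj a b → c a ≠ c b

section PartialColoring

variable {V : Type*} {K : SimpleGraph V} {n : ℕ} {c : V → Fin n} {p q : V}

lemma ProperOff.colorable (hc : ProperOff K ∅ c) : K.Colorable n :=
  ⟨Coloring.mk c fun h => hc (Set.notMem_empty _) (Set.notMem_empty _) h⟩

lemma ProperOff.fill_color {X : Set V} (hc : ProperOff K X c) {x : Fin n}
    (hx : ∀ q, K.Adj p q → c q ≠ x) :
    ProperOff K (X \ {p}) (Function.update c p x) := by
  intro a b ha hb hab
  simp only [Set.mem_sdiff, Set.mem_singleton_iff, not_and, not_not] at ha hb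
  by_cases hap : a = p
  · subst hap
    rw [Function.update_self, Function.update_of_ne hab.ne']
    exact (hx b hab).symm
  · by_cases hbp : b = p
    · subst hbp
      rw [Function.update_self, Function.update_of_ne hab.ne]
      exact hx a hab.symm
    · rw [Function.update_of_ne hap, Function.update_of_ne hbp]
      exact hc (fun h => hap (ha h)) (fun h => hbp (hb h)) hab

variable [Fintype V]

lemma ProperOff.fill {X : Set V} (hc : ProperOff K X c) (hp : K.degree p < n) :
    ∃ c' : V → Fin n, ProperOff K (X \ {p}) c' := by
  obtain ⟨x, hx⟩ : ∃ x, x ∉ (K.neighborFinset p).image c := by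
    by_contra! h
    have h1 : (Finset.univ : Finset (Fin n)) ⊆ (K.neighborFinset p).image c := fun x _ => h x
    have h2 := (Finset.card_le_card h1).trans Finset.card_image_le
    simp at h2
    omega
  exact ⟨_, hc.fill_color (p := p) (x := x) fun q hq h =>
    hx (Finset.mem_image.2 ⟨q, by simpa using hq, h⟩)⟩

omit [Fintype V] in
lemma ProperOff.exists_adj_eq (hK : ¬ K.Colorable n) (hc : ProperOff K {p} c) (x : Fin n) :
    ∃ q, K.Adj p q ∧ c q = x := by
  by_contra! h
  have := hc.fill_color h
  rw [Set.sdiff_self] at this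
  exact hK this.colorable

lemma ProperOff.le_degree (hK : ¬ K.Colorable n) (hc : ProperOff K {p} c) : n ≤ K.degree p := by
  by_contra! h
  obtain ⟨c', hc'⟩ := hc.fill h
  rw [Set.sdiff_self] at hc'
  exact hK hc'.colorable

lemma ProperOff.injOn (hK : ¬ K.Colorable n) (hc : ProperOff K {p} c) (hp : K.degree p ≤ n) :
    Set.InjOn c {q | K.Adj p q} := by
  have h1 : (K.neighborFinset p).image c = Finset.univ := by
    ext x
    obtain ⟨q, hq, hx⟩ := hc.exists_adj_eq hK x
    simpa using ⟨q, hq, hx⟩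
  have h2 : ((K.neighborFinset p).image c).card = (K.neighborFinset p).card := by
    refine le_antisymm Finset.card_image_le ?_
    rw [h1]
    simpa using hp
  have h3 := Finset.card_image_iff.1 h2
  intro a ha b hb
  exact h3 (by simpa using ha) (by simpa using hb)

lemma ProperOff.shift (hK : ¬ K.Colorable n) (hc : ProperOff K {p} c) (hp : K.degree p ≤ n)
    (hpq : K.Adj p q) : ProperOff K {q} (Function.update c p (c q)) := by
  have hinj := hc.injOn hK hp
  intro a b ha hb hab
  simp only [Set.mem_singleton_iff] at ha hb
  by_cases hap : a = p
  · subst hap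
    rw [Function.update_self, Function.update_of_ne hab.ne']
    exact fun h => hb (hinj hpq hab h).symm
  · by_cases hbp : b = p
    · subst hbp
      rw [Function.update_self, Function.update_of_ne hab.ne]
      exact fun h => ha (hinj hab.symm hpq h)
    · rw [Function.update_of_ne hap, Function.update_of_ne hbp]
      exact hc hap hbp hab

lemma exists_properOff_of_chain (hK : ¬ K.Colorable n) {A : Set V} (hA : ∀ a ∈ A, K.degree a ≤ n)
    (hp : p ∈ A) (hc : ProperOff K {p} c)
    (hpq : Relation.ReflTransGen (fun a b => K.Adj a b ∧ b ∈ A) p q) :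
    q ∈ A ∧ ∃ c' : V → Fin n, ProperOff K {q} c' ∧ ∀ a ∉ A, c' a = c a := by
  induction hpq with
  | refl => exact ⟨hp, c, hc, fun _ _ => rfl⟩
  | tail _ hbq ih =>
    obtain ⟨hb, c', hc', h⟩ := ih
    refine ⟨hbq.2, _, hc'.shift hK (hA _ hb) hbq.1, fun a ha => ?_⟩
    rw [Function.update_of_ne (ne_of_mem_of_not_mem hb ha).symm, h a ha]

/-- A triangle `e₁ f e₂` in which `e₁` and `e₂` are joined by a further path avoiding the closed
neighborhood of `f` cannot occur among the vertices of degree at most `n` to which a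
coloring with one uncolored vertex can be moved. -/
lemma ProperOff.false_of_triangle_of_chain (hK : ¬ K.Colorable n) {e₁ e₂ f : V}
    {A : Set V} (hA : ∀ a ∈ A, K.degree a ≤ n ∧ a ≠ f ∧ ¬ K.Adj f a)
    (hd₁ : K.degree e₁ ≤ n) (hd₂ : K.degree e₂ ≤ n) (hdf : K.degree f ≤ n)
    (h₁f : K.Adj e₁ f) (h₂f : K.Adj e₂ f) (h₁₂ : K.Adj e₁ e₂)
    (hp : p ∈ A) (h₁p : K.Adj e₁ p) (hq₂ : K.Adj q e₂)
    (hpq : Relation.ReflTransGen (fun a b => K.Adj a b ∧ b ∈ A) p q)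
    (hc : ProperOff K {e₁} c) : False := by
  have hinj := hc.injOn hK hd₁
  have h1A : e₁ ∉ A := fun h => (hA _ h).2.2 h₁f.symm
  have h2A : e₂ ∉ A := fun h => (hA _ h).2.2 h₂f.symm
  obtain ⟨hqA, c₁, hc₁, h₁⟩ := exists_properOff_of_chain hK (fun a ha => (hA a ha).1) hp
    (hc.shift hK hd₁ h₁p) hpq
  have hc₂ := (hc₁.shift hK (hA _ hqA).1 hq₂).shift hK hd₂ h₂f
  have hinj₂ := hc₂.injOn hK hdf
  obtain ⟨g, hg, hgc⟩ := (hc.shift hK hd₁ h₁f).exists_adj_eq hK (c p)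
  by_cases hg1 : g = e₁
  · subst hg1
    rw [Function.update_self] at hgc
    exact (hA _ hp).2.1 (hinj h₁p h₁f hgc.symm)
  rw [Function.update_of_ne hg1] at hgc
  by_cases hg2 : g = e₂
  · subst hg2
    have := hinj h₁p h₁₂ hgc.symm
    exact h2A (this ▸ hp)
  have hgA : g ∉ A := fun h => (hA _ h).2.2 hg
  refine hg1 (hinj₂ hg h₁f.symm ?_)
  rw [Function.update_of_ne hg2, Function.update_of_ne (ne_of_mem_of_not_mem hqA hgA).symm,
    h₁ _ hgA, Function.update_of_ne hg1, Function.update_of_ne h₁₂.ne,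
    Function.update_of_ne (ne_of_mem_of_not_mem hqA h1A).symm, h₁ _ h1A, Function.update_self, hgc]

end PartialColoring

section Walks

variable {V : Type*} {F : SimpleGraph V}

/-- Among three neighbors of a vertex on a cycle, two are joined by a walk which avoids
that vertex and the third one. -/
lemma exists_walk_avoiding_of_isCycle [Fintype V] {x : V} {w : F.Walk x x} (hw : w.IsCycle)
    (hx : 3 ≤ F.degree x) :
    ∃ y₁ y₂ z, F.Adj x y₁ ∧ F.Adj x y₂ ∧ F.Adj x z ∧ y₁ ≠ y₂ ∧ z ≠ y₁ ∧ z ≠ y₂ ∧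
      ∃ p : F.Walk y₁ y₂, x ∉ p.support ∧ z ∉ p.support := by
  obtain ⟨y₁, y₂, h₁, h₂, h₁₂, p, hp, hxp⟩ : ∃ y₁ y₂, F.Adj x y₁ ∧ F.Adj x y₂ ∧ y₁ ≠ y₂ ∧
      ∃ p : F.Walk y₁ y₂, p.IsPath ∧ x ∉ p.support := by
    cases w with
    | nil => exact absurd rfl hw.ne_nil
    | @cons _ y₁ _ h r =>
      obtain ⟨hr, hxr⟩ := (Walk.cons_isCycle_iff r h).1 hw
      rw [← Walk.isPath_reverse_iff] at hr
      rw [← List.mem_reverse, ← Walk.edges_reverse] at hxr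
      generalize r.reverse = q at hr hxr
      cases q with
      | nil => exact (h.ne rfl).elim
      | @cons _ y₂ _ h' q =>
        rw [Walk.cons_isPath_iff] at hr
        refine ⟨y₂, y₁, h', h, ?_, q, hr.1, hr.2⟩
        rintro rfl
        simp at hxr
  obtain ⟨z, hz, hz₁, hz₂⟩ : ∃ z, F.Adj x z ∧ z ≠ y₁ ∧ z ≠ y₂ := by
    have h3 : ({y₁, y₂} : Finset V).card < (F.neighborFinset x).card := by
      rw [F.card_neighborFinset_eq_degree]
      exact Finset.card_le_two.trans_lt hx
    obtain ⟨z, hz, hz'⟩ := Finset.exists_mem_notMem_of_card_lt_card h3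
    simp at hz hz'
    exact ⟨z, hz, hz'⟩
  by_cases hzp : z ∈ p.support
  · exact ⟨y₁, z, y₂, h₁, hz, h₂, hz₁.symm, h₁₂.symm, hz₂.symm, p.takeUntil z hzp,
      fun h => hxp (p.support_takeUntil_subset_support hzp h),
      Walk.endpoint_notMem_support_takeUntil hp hzp hz₂.symm⟩
  · exact ⟨y₁, y₂, z, h₁, h₂, hz, h₁₂, hz₁, hz₂, p, hxp, hzp⟩

/-- If no vertex of degree at least three lies on a cycle, then the component of such a vertex
contains no cycle. -/
lemma not_isCycle_of_reachable [Fintype V] {v : V} (hv : 3 ≤ F.degree v)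
    (h : ∀ x, F.Reachable v x → 3 ≤ F.degree x → ∀ w : F.Walk x x, ¬ w.IsCycle)
    {x : V} (hx : F.Reachable v x) (w : F.Walk x x) : ¬ w.IsCycle := by
  intro hw
  have key : ∀ y, F.Reachable x y → ∃ w : F.Walk y y, w.IsCycle := by
    intro y hy
    rw [SimpleGraph.reachable_iff_reflTransGen] at hy
    induction hy with
    | refl => exact ⟨w, hw⟩
    | @tail b y hb hby ih =>
      obtain ⟨w, hw⟩ := ih
      rw [← SimpleGraph.reachable_iff_reflTransGen] at hb
      have hdeg : F.degree b ≤ 2 := by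
        by_contra! h'
        exact h b (hx.trans hb) h' w hw
      have hmem : y ∈ w.support := by
        by_contra hy
        have h1 : w.snd ∈ w.support := w.getVert_mem_support _
        have h2 : w.penultimate ∈ w.support := w.getVert_mem_support _
        have h3 : ({y, w.snd, w.penultimate} : Finset V).card = 3 :=
          Finset.card_eq_three.2 ⟨_, _, _, (ne_of_mem_of_not_mem h1 hy).symm,
            (ne_of_mem_of_not_mem h2 hy).symm, hw.snd_ne_penultimate, rfl⟩
        have h4 : ({y, w.snd, w.penultimate} : Finset V) ⊆ F.neighborFinset b := by
          intro z
          simp only [Finset.mem_insert, Finset.mem_singleton, mem_neighborFinset]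
          rintro (rfl | rfl | rfl)
          · exact hby
          · exact w.adj_snd hw.not_nil
          · exact (w.adj_penultimate hw.not_nil).symm
        have := Finset.card_le_card h4
        rw [F.card_neighborFinset_eq_degree] at this
        omega
      exact ⟨_, hw.rotate hmem⟩
  obtain ⟨w', hw'⟩ := key v hx.symm
  exact h v (Reachable.refl v) hv w' hw'

lemma IsAcyclic.sum_degree_le [Fintype V] (hF : F.IsAcyclic) :
    ∑ v, F.degree v ≤ 2 * Fintype.card V := by
  cases isEmpty_or_nonempty V
  · simp
  · obtain ⟨T, hFT, -, hT⟩ :=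
      (connected_top (V := V)).exists_isTree_le_of_le_of_isAcyclic le_top hF
    have h1 := hT.card_edgeFinset
    have h2 : F.edgeFinset.card ≤ T.edgeFinset.card :=
      Finset.card_le_card (edgeFinset_subset_edgeFinset.2 hFT)
    rw [F.sum_degrees_eq_twice_card_edges]
    omega

lemma sum_degree_le_of_forall_not_isCycle [Fintype V] (S : Finset V)
    (hS : ∀ x ∈ S, ∀ y, F.Adj x y → y ∈ S)
    (h : ∀ x ∈ S, ∀ w : F.Walk x x, ¬ w.IsCycle) :
    ∑ v ∈ S, F.degree v ≤ 2 * S.card := by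
  have hac : (F.induce (S : Set V)).IsAcyclic := by
    intro x w hw
    let φ : F.induce (S : Set V) ↪g F := Embedding.induce (S : Set V)
    exact h x x.2 (w.map φ.toHom) (hw.map φ.injective)
  have h1 : ∑ x : (S : Set V), (F.induce (S : Set V)).degree x ≤ 2 * S.card := by
    convert IsAcyclic.sum_degree_le hac
    simp
  have h2 : ∀ x : (S : Set V), (F.induce (S : Set V)).degree x = F.degree x := by
    intro x
    rw [← degree_induce_of_neighborSet_subset (G := F) (s := (S : Set V)) (v := x)
      (fun y hy => hS x x.2 y hy)]
    congr!
  rw [Finset.sum_congr rfl fun x _ => h2 x] at h1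
  rw [← Finset.sum_coe_sort S]
  exact h1

end Walks

section Conflict

variable {V : Type*} [Fintype V] {G : SimpleGraph V}

lemma conflictGraph_degree_le (u : V) :
    (conflictGraph G).degree u ≤ ∑ w ∈ G.neighborFinset u, (G.degree w - 1) := by
  have h : (conflictGraph G).neighborFinset u ⊆
      (G.neighborFinset u).biUnion fun w => (G.neighborFinset w).erase u := by
    intro x hx
    obtain ⟨hne, w, huw, hxw⟩ := (mem_neighborFinset _ _ _).1 hx
    simp only [Finset.mem_biUnion, mem_neighborFinset, Finset.mem_erase]
    exact ⟨w, huw, hne.symm, hxw.symm⟩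
  rw [← card_neighborFinset_eq_degree]
  refine (Finset.card_le_card h).trans (Finset.card_biUnion_le.trans (Finset.sum_le_sum ?_))
  intro w hw
  rw [Finset.card_erase_of_mem (by simpa using ((mem_neighborFinset _ _ _).1 hw).symm),
    card_neighborFinset_eq_degree]

lemma conflictGraph_degree_le_of_adj (hΔ : ∀ w, G.degree w ≤ 4) {u x : V} (hux : G.Adj u x) :
    (conflictGraph G).degree u ≤ (G.degree x - 1) + 3 * (G.degree u - 1) := by
  refine (conflictGraph_degree_le u).trans ?_
  have hx : x ∈ G.neighborFinset u := by simpa using hux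
  rw [← Finset.add_sum_erase _ _ hx]
  gcongr
  refine (Finset.sum_le_card_nsmul _ _ 3 fun w _ => ?_).trans ?_
  · have := hΔ w
    omega
  · rw [Finset.card_erase_of_mem hx, card_neighborFinset_eq_degree, smul_eq_mul, mul_comm]

lemma eq_or_eq_of_degree_eq_two {u a b w : V} (hu : G.degree u = 2) (hab : a ≠ b)
    (ha : G.Adj u a) (hb : G.Adj u b) (hw : G.Adj u w) : w = a ∨ w = b := by
  have h1 : ({a, b} : Finset V) ⊆ G.neighborFinset u := by
    intro z
    simp only [Finset.mem_insert, Finset.mem_singleton, mem_neighborFinset]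
    rintro (rfl | rfl) <;> assumption
  have h2 := Finset.eq_of_subset_of_card_le h1
    (by rw [card_neighborFinset_eq_degree, Finset.card_pair hab, hu])
  have h3 : w ∈ G.neighborFinset u := by simpa using hw
  simpa [← h2] using h3

lemma exists_adj_ne_of_two_le_degree {u : V} (hu : 2 ≤ G.degree u) (a : V) :
    ∃ b, b ≠ a ∧ G.Adj u b := by
  have h : ({a} : Finset V).card < (G.neighborFinset u).card := by
    rw [card_neighborFinset_eq_degree, Finset.card_singleton]
    omega
  obtain ⟨b, hb, hba⟩ := Finset.exists_mem_notMem_of_card_lt_card h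
  exact ⟨b, by simpa using hba, by simpa using hb⟩

/-- Two vertices with two common neighbors of degree at most four. -/
lemma conflictGraph_degree_lt_six (hΔ : ∀ w, G.degree w ≤ 4) {u u' a b : V}
    (hu : G.degree u = 2) (huu' : u ≠ u') (hab : a ≠ b) (ha : G.Adj u a) (hb : G.Adj u b)
    (ha' : G.Adj u' a) (hb' : G.Adj u' b) : (conflictGraph G).degree u < 6 := by
  have h : (conflictGraph G).neighborFinset u ⊆
      (G.neighborFinset a).erase u ∪ (G.neighborFinset b).erase u := by
    intro x hx
    obtain ⟨hne, w, huw, hxw⟩ := (mem_neighborFinset _ _ _).1 hx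
    simp only [Finset.mem_union, mem_neighborFinset, Finset.mem_erase]
    obtain rfl | rfl := eq_or_eq_of_degree_eq_two hu hab ha hb huw
    · exact Or.inl ⟨hne.symm, hxw.symm⟩
    · exact Or.inr ⟨hne.symm, hxw.symm⟩
  have h1 := Finset.card_le_card h
  have h2 := Finset.card_union_add_card_inter ((G.neighborFinset a).erase u)
    ((G.neighborFinset b).erase u)
  have h3 : 0 < ((G.neighborFinset a).erase u ∩ (G.neighborFinset b).erase u).card :=
    Finset.card_pos.2 ⟨u', by simp [huu'.symm, ha'.symm, hb'.symm]⟩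
  rw [Finset.card_erase_of_mem (by simpa using ha.symm),
    Finset.card_erase_of_mem (by simpa using hb.symm)] at h2
  simp only [card_neighborFinset_eq_degree] at h1 h2
  have := hΔ a
  have := hΔ b
  omega

/-- An edge-minimal graph of maximum degree at most four without an injective coloring with
six colors. -/
structure IsInjCritical (G : SimpleGraph V) : Prop where
  degree_le : ∀ v, G.degree v ≤ 4
  not_colorable : ¬ (conflictGraph G).Colorable 6
  colorable_deleteEdges : ∀ u v, G.Adj u v → (conflictGraph (G.deleteEdges {s(u, v)})).Colorable 6

namespace IsInjCritical

lemma exists_properOff (hG : IsInjCritical G) {u v : V} (huv : G.Adj u v) :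
    ∃ c : V → Fin 6, ProperOff (conflictGraph G) {u, v} c ∧
      (G.degree u = 1 → ProperOff (conflictGraph G) {u} c) := by
  obtain ⟨C⟩ := hG.colorable_deleteEdges u v huv
  refine ⟨C, fun a b ha hb ⟨hab, w, haw, hbw⟩ => C.valid ⟨hab, w, ?_, ?_⟩,
    fun hu a b ha hb ⟨hab, w, haw, hbw⟩ => ?_⟩
  · simp only [deleteEdges_adj, Set.mem_singleton_iff, Sym2.eq_iff]
    simp only [Set.mem_insert_iff, Set.mem_singleton_iff] at ha
    tauto
  · simp only [deleteEdges_adj, Set.mem_singleton_iff, Sym2.eq_iff]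
    simp only [Set.mem_insert_iff, Set.mem_singleton_iff] at hb
    tauto
  · simp only [Set.mem_singleton_iff] at ha hb
    have hwu : w ≠ u := by
      rintro rfl
      obtain ⟨z, hz⟩ := Finset.card_eq_one.1 ((G.card_neighborFinset_eq_degree w).trans hu)
      have h1 : a ∈ G.neighborFinset w := by simpa using haw.symm
      have h2 : b ∈ G.neighborFinset w := by simpa using hbw.symm
      rw [hz, Finset.mem_singleton] at h1 h2
      exact hab (h1.trans h2.symm)
    refine C.valid ⟨hab, w, ?_, ?_⟩ <;>
    · simp only [deleteEdges_adj, Set.mem_singleton_iff, Sym2.eq_iff]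
      tauto

lemma six_le_degree_or (hG : IsInjCritical G) {u v : V} (huv : G.Adj u v) :
    6 ≤ (conflictGraph G).degree u ∨ 6 ≤ (conflictGraph G).degree v := by
  by_contra! h
  obtain ⟨c, hc, -⟩ := hG.exists_properOff huv
  obtain ⟨c₁, hc₁⟩ := hc.fill h.1
  obtain ⟨c₂, hc₂⟩ := hc₁.fill h.2
  rw [show (({u, v} : Set V) \ {u}) \ {v} = ∅ by ext; simp] at hc₂
  exact hG.not_colorable hc₂.colorable

lemma two_le_degree (hG : IsInjCritical G) {u v : V} (huv : G.Adj u v) : 2 ≤ G.degree u := by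
  by_contra! h
  have h1 : G.degree u = 1 := by
    have : 0 < G.degree u := (G.degree_pos_iff_exists_adj u).2 ⟨v, huv⟩
    omega
  obtain ⟨c, -, hc⟩ := hG.exists_properOff huv
  have h2 := (hc h1).le_degree hG.not_colorable
  have h3 := conflictGraph_degree_le_of_adj hG.degree_le huv
  have := hG.degree_le v
  omega

lemma three_le_degree (hG : IsInjCritical G) {u v : V} (huv : G.Adj u v) (hu : G.degree u = 2) :
    3 ≤ G.degree v := by
  by_contra! h
  have := hG.six_le_degree_or huv
  have h1 := conflictGraph_degree_le_of_adj hG.degree_le huv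
  have h2 := conflictGraph_degree_le_of_adj hG.degree_le huv.symm
  omega

lemma six_le_sum_of_degree_eq_three (hG : IsInjCritical G) {u v : V} (huv : G.Adj u v)
    (hu : G.degree u = 2) (hv : G.degree v = 3) :
    6 ≤ ∑ w ∈ G.neighborFinset v, (G.degree w - 1) := by
  have := hG.six_le_degree_or huv
  have h1 := conflictGraph_degree_le_of_adj hG.degree_le huv
  have h2 := conflictGraph_degree_le (G := G) v
  omega

end IsInjCritical

/-- The conflict graph with all edges at `v` removed. -/
def conflictGraphOff (G : SimpleGraph V) (v : V) : SimpleGraph V where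
  Adj a b := (conflictGraph G).Adj a b ∧ a ≠ v ∧ b ≠ v
  symm := ⟨fun _ _ ⟨h, ha, hb⟩ => ⟨h.symm, hb, ha⟩⟩
  loopless := ⟨fun _ h => h.1.ne rfl⟩

/-- Distinct vertices are adjacent when they have a common neighbor of degree two in `G`. -/
def twoGraph (G : SimpleGraph V) : SimpleGraph V where
  Adj a b := a ≠ b ∧ ∃ u, G.degree u = 2 ∧ G.Adj u a ∧ G.Adj u b
  symm := ⟨fun _ _ ⟨h, u, hu, ha, hb⟩ => ⟨h.symm, u, hu, hb, ha⟩⟩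
  loopless := ⟨fun _ h => h.1 rfl⟩

/-- The number of neighbors of degree two. -/
noncomputable def twoDegree (G : SimpleGraph V) (y : V) : ℕ :=
  ((G.neighborFinset y).filter fun u => G.degree u = 2).card

lemma conflictGraphOff_degree_le (v a : V) :
    (conflictGraphOff G v).degree a ≤ (conflictGraph G).degree a := by
  simp only [← card_neighborFinset_eq_degree]
  refine Finset.card_le_card fun x hx => ?_
  rw [mem_neighborFinset] at hx ⊢
  exact hx.1

lemma conflictGraphOff_degree_le_six (hΔ : ∀ w, G.degree w ≤ 4) (v : V) {u : V}
    (hu : G.degree u = 2) : (conflictGraphOff G v).degree u ≤ 6 := by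
  obtain ⟨x, -, hx⟩ := exists_adj_ne_of_two_le_degree hu.ge u
  have h1 := conflictGraphOff_degree_le (G := G) v u
  have h2 := conflictGraph_degree_le_of_adj hΔ hx
  have := hΔ x
  omega

lemma conflictGraphOff_adj {v a b w : V} (hv : G.degree v ≠ 2) (ha : G.degree a = 2)
    (hb : G.degree b = 2) (hab : a ≠ b) (haw : G.Adj a w) (hbw : G.Adj b w) :
    (conflictGraphOff G v).Adj a b :=
  ⟨⟨hab, w, haw, hbw⟩, fun h => hv (h ▸ ha), fun h => hv (h ▸ hb)⟩

/-- A vertex of degree at least three with few conflicts. -/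
structure IsRich (G : SimpleGraph V) (v : V) : Prop where
  degree_lt : (conflictGraph G).degree v < 6
  three_le : 3 ≤ twoDegree G v

namespace IsRich

variable {v : V}

lemma degree_ne_two (hv : IsRich G v) : G.degree v ≠ 2 := by
  have h1 := hv.three_le
  have h2 : twoDegree G v ≤ (G.neighborFinset v).card := Finset.card_filter_le _ _
  rw [card_neighborFinset_eq_degree] at h2
  omega

lemma not_colorable (hv : IsRich G v) (hG : IsInjCritical G) :
    ¬ (conflictGraphOff G v).Colorable 6 := by
  rintro ⟨C⟩
  have hC : ProperOff (conflictGraph G) {v} C := fun a b ha hb hab => C.valid ⟨hab, ha, hb⟩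
  exact hv.degree_lt.not_ge (hC.le_degree hG.not_colorable)

lemma exists_properOff (hv : IsRich G v) (hG : IsInjCritical G) {y u : V}
    (hy : (twoGraph G).Reachable v y) (hyu : G.Adj y u) (hu : G.degree u = 2) :
    ∃ c : V → Fin 6, ProperOff (conflictGraphOff G v) {u} c := by
  rw [reachable_iff_reflTransGen] at hy
  induction hy generalizing u with
  | refl =>
    obtain ⟨c, hc, -⟩ := hG.exists_properOff hyu
    refine ⟨c, fun a b ha hb ⟨hab, hav, hbv⟩ => hc ?_ ?_ hab⟩
    · simpa using ⟨hav, ha⟩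
    · simpa using ⟨hbv, hb⟩
  | tail _ hby ih =>
    obtain ⟨hne, w, hw, hwb, hwy⟩ := hby
    obtain ⟨c, hc⟩ := ih hwb.symm hw
    obtain rfl | huw := eq_or_ne w u
    · exact ⟨c, hc⟩
    · exact ⟨_, hc.shift (hv.not_colorable hG) (conflictGraphOff_degree_le_six hG.degree_le v hw)
        (conflictGraphOff_adj hv.degree_ne_two hw hu huw hwy hyu.symm)⟩

lemma six_le_degree (hv : IsRich G v) (hG : IsInjCritical G) {y u : V}
    (hy : (twoGraph G).Reachable v y) (hyu : G.Adj y u) (hu : G.degree u = 2) :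
    6 ≤ (conflictGraph G).degree u := by
  obtain ⟨c, hc⟩ := hv.exists_properOff hG hy hyu hu
  exact (hc.le_degree (hv.not_colorable hG)).trans (conflictGraphOff_degree_le v u)

lemma twoDegree_le (hv : IsRich G v) (hG : IsInjCritical G) {y : V}
    (hy : (twoGraph G).Reachable v y) : twoDegree G y ≤ (twoGraph G).degree y := by
  have h : ∀ u, ∃ b, G.degree u = 2 → b ≠ y ∧ G.Adj u b := fun u => by
    by_cases hu : G.degree u = 2
    · obtain ⟨b, hb⟩ := exists_adj_ne_of_two_le_degree hu.ge y
      exact ⟨b, fun _ => hb⟩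
    · exact ⟨y, fun h => absurd h hu⟩
  choose g hg using h
  rw [twoDegree, ← card_neighborFinset_eq_degree]
  refine Finset.card_le_card_of_injOn g (fun u hu => ?_) fun u hu u' hu' huu' => ?_
  · simp only [Finset.coe_filter, mem_neighborFinset, Set.mem_ofPred_eq] at hu
    simp only [Finset.mem_coe, mem_neighborFinset]
    exact ⟨(hg u hu.2).1.symm, u, hu.2, hu.1.symm, (hg u hu.2).2⟩
  · simp only [Finset.coe_filter, mem_neighborFinset, Set.mem_ofPred_eq] at hu hu'
    by_contra hne
    have h1 := hv.six_le_degree hG hy hu.1 hu.2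
    have h2 := conflictGraph_degree_lt_six hG.degree_le hu.2 hne (hg u hu.2).1.symm hu.1.symm
      (hg u hu.2).2 hu'.1.symm (huu' ▸ (hg u' hu'.2).2)
    omega

lemma degree_eq_four (hv : IsRich G v) (hG : IsInjCritical G) {y : V}
    (hy : (twoGraph G).Reachable v y) : G.degree y = 4 := by
  have key : ∃ u x, (twoGraph G).Reachable v x ∧ G.Adj x u ∧ G.degree u = 2 ∧ G.Adj u y := by
    rw [reachable_iff_reflTransGen] at hy
    cases hy with
    | refl =>
      have h : 0 < twoDegree G v := by have := hv.three_le; omega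
      obtain ⟨u, hu⟩ := Finset.card_pos.1 h
      simp only [Finset.mem_filter, mem_neighborFinset] at hu
      exact ⟨u, v, Reachable.refl v, hu.1, hu.2, hu.1.symm⟩
    | @tail b _ hb hby =>
      obtain ⟨-, u, hu, hub, huy⟩ := hby
      exact ⟨u, b, (reachable_iff_reflTransGen _ _).2 hb, hub.symm, hu, huy⟩
  obtain ⟨u, x, hx, hxu, hu, huy⟩ := key
  have h1 := hv.six_le_degree hG hx hxu hu
  have h2 := conflictGraph_degree_le_of_adj hG.degree_le huy
  have := hG.degree_le y
  omega

lemma exists_chain (hv : IsRich G v) {x z y₁ y₂ : V} (p : (twoGraph G).Walk y₁ y₂)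
    (hx : x ∉ p.support) (hz : z ∉ p.support) {A : Set V}
    (hA : A = {a | G.degree a = 2 ∧ ∀ w, G.Adj a w → w ≠ x ∧ w ≠ z}) {e : V} (he : e ∈ A)
    (hey : G.Adj e y₁) :
    ∃ e' ∈ A, G.Adj e' y₂ ∧
      Relation.ReflTransGen (fun a b => (conflictGraphOff G v).Adj a b ∧ b ∈ A) e e' := by
  induction p generalizing e with
  | nil => exact ⟨e, he, hey, .refl⟩
  | @cons y₁ y _ h q ih =>
    simp only [Walk.support_cons, List.mem_cons, not_or] at hx hz
    obtain ⟨hne, g, hg, hg₁, hgy⟩ := h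
    have hgA : g ∈ A := by
      rw [hA]
      refine ⟨hg, fun w hw => ?_⟩
      obtain rfl | rfl := eq_or_eq_of_degree_eq_two hg hne hg₁ hgy hw
      · exact ⟨Ne.symm hx.1, Ne.symm hz.1⟩
      · exact ⟨fun h => hx.2 (h ▸ q.start_mem_support), fun h => hz.2 (h ▸ q.start_mem_support)⟩
    obtain ⟨e', he', he'y, hchain⟩ := ih hx.2 hz.2 hgA hgy
    refine ⟨e', he', he'y, ?_⟩
    obtain rfl | heg := eq_or_ne e g
    · exact hchain
    · have he2 : G.degree e = 2 := by rw [hA] at he; exact he.1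
      exact .head ⟨conflictGraphOff_adj hv.degree_ne_two he2 hg heg hey hg₁, hgA⟩ hchain

lemma not_isCycle_of_three_le (hv : IsRich G v) (hG : IsInjCritical G) {x : V}
    (hx : (twoGraph G).Reachable v x) (hd : 3 ≤ (twoGraph G).degree x)
    (w : (twoGraph G).Walk x x) : ¬ w.IsCycle := by
  intro hw
  obtain ⟨y₁, y₂, z, h₁, h₂, hz, h₁₂, hz₁, hz₂, p, hxp, hzp⟩ :=
    exists_walk_avoiding_of_isCycle hw hd
  obtain ⟨-, e₁, he₁, he₁x, he₁y⟩ := h₁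
  obtain ⟨-, e₂, he₂, he₂x, he₂y⟩ := h₂
  obtain ⟨hxz, f, hf, hfx, hfz⟩ := hz
  have hxy₁ : x ≠ y₁ := fun h => hxp (h ▸ p.start_mem_support)
  have hxy₂ : x ≠ y₂ := fun h => hxp (h ▸ p.end_mem_support)
  obtain ⟨A, hA⟩ : ∃ A : Set V, A = {a | G.degree a = 2 ∧ ∀ w, G.Adj a w → w ≠ x ∧ w ≠ z} :=
    ⟨_, rfl⟩
  have hA' : ∀ a ∈ A, (conflictGraphOff G v).degree a ≤ 6 ∧ a ≠ f ∧
      ¬ (conflictGraphOff G v).Adj f a := by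
    intro a ha
    rw [hA] at ha
    refine ⟨conflictGraphOff_degree_le_six hG.degree_le v ha.1, ?_, ?_⟩
    · rintro rfl
      exact (ha.2 x hfx).1 rfl
    · rintro ⟨⟨-, w, hfw, haw⟩, -⟩
      obtain h | h := eq_or_eq_of_degree_eq_two hf hxz hfx hfz hfw
      · exact (ha.2 w haw).1 h
      · exact (ha.2 w haw).2 h
  obtain ⟨g, hgA, hgy, e', he'A, he'y, hchain⟩ : ∃ g ∈ A, G.Adj g y₁ ∧ ∃ e' ∈ A, G.Adj e' y₂ ∧
      Relation.ReflTransGen (fun a b => (conflictGraphOff G v).Adj a b ∧ b ∈ A) g e' := by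
    cases p with
    | nil => exact (h₁₂ rfl).elim
    | @cons _ y _ h q =>
      simp only [Walk.support_cons, List.mem_cons, not_or] at hxp hzp
      obtain ⟨hne, g, hg, hg₁, hgy⟩ := h
      have hgA : g ∈ A := by
        rw [hA]
        refine ⟨hg, fun w hw => ?_⟩
        obtain rfl | rfl := eq_or_eq_of_degree_eq_two hg hne hg₁ hgy hw
        · exact ⟨Ne.symm hxp.1, Ne.symm hzp.1⟩
        · exact ⟨fun h => hxp.2 (h ▸ q.start_mem_support),
            fun h => hzp.2 (h ▸ q.start_mem_support)⟩
      exact ⟨g, hgA, hg₁, hv.exists_chain q hxp.2 hzp.2 hA hgA hgy⟩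
  have hne : ∀ a b y y', G.degree a = 2 → G.Adj a x → G.Adj a y → G.Adj b y' → x ≠ y → x ≠ y' →
      y ≠ y' → a ≠ b := by
    rintro a b y y' ha hax hay hby hxy hxy' hyy' rfl
    obtain h | h := eq_or_eq_of_degree_eq_two ha hxy hax hay hby
    · exact hxy' h.symm
    · exact hyy' h.symm
  have hnA : ∀ a, G.Adj a x → ∀ b ∈ A, a ≠ b := by
    rintro a hax b hb rfl
    rw [hA] at hb
    exact (hb.2 x hax).1 rfl
  have hA2 : ∀ a ∈ A, G.degree a = 2 := fun a ha => by rw [hA] at ha; exact ha.1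
  have hdeg : ∀ a, G.degree a = 2 → (conflictGraphOff G v).degree a ≤ 6 := fun a ha =>
    conflictGraphOff_degree_le_six hG.degree_le v ha
  have hv2 := hv.degree_ne_two
  obtain ⟨c, hc⟩ := hv.exists_properOff hG hx he₁x.symm he₁
  exact hc.false_of_triangle_of_chain (hv.not_colorable hG) hA' (hdeg _ he₁) (hdeg _ he₂)
    (hdeg _ hf)
    (conflictGraphOff_adj hv2 he₁ hf (hne _ _ _ _ he₁ he₁x he₁y hfz hxy₁ hxz hz₁.symm) he₁x hfx)
    (conflictGraphOff_adj hv2 he₂ hf (hne _ _ _ _ he₂ he₂x he₂y hfz hxy₂ hxz hz₂.symm) he₂x hfx)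
    (conflictGraphOff_adj hv2 he₁ he₂ (hne _ _ _ _ he₁ he₁x he₁y he₂y hxy₁ hxy₂ h₁₂) he₁x he₂x)
    hgA (conflictGraphOff_adj hv2 he₁ (hA2 _ hgA) (hnA _ he₁x _ hgA) he₁y hgy)
    (conflictGraphOff_adj hv2 (hA2 _ he'A) he₂ (hnA _ he₂x _ he'A).symm he'y he₂y) hchain

lemma not_isCycle (hv : IsRich G v) (hG : IsInjCritical G) {x : V}
    (hx : (twoGraph G).Reachable v x) (w : (twoGraph G).Walk x x) : ¬ w.IsCycle :=
  not_isCycle_of_reachable (hv.three_le.trans (hv.twoDegree_le hG (Reachable.refl v)))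
    (fun _ hx hd => hv.not_isCycle_of_three_le hG hx hd) hx w

end IsRich

lemma IsInjCritical.sum_twoDegree_le (hG : IsInjCritical G) :
    ∑ y with ∃ v, IsRich G v ∧ (twoGraph G).Reachable v y, (twoDegree G y : ℤ) ≤
      ∑ y with ∃ v, IsRich G v ∧ (twoGraph G).Reachable v y, 2 := by
  set S : Finset V := {y | ∃ v, IsRich G v ∧ (twoGraph G).Reachable v y} with hS
  have hmem : ∀ y, y ∈ S ↔ ∃ v, IsRich G v ∧ (twoGraph G).Reachable v y := by simp [hS]
  have h1 : ∑ y ∈ S, twoDegree G y ≤ ∑ y ∈ S, (twoGraph G).degree y := by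
    refine Finset.sum_le_sum fun y hy => ?_
    obtain ⟨v, hv, hvy⟩ := (hmem y).1 hy
    exact hv.twoDegree_le hG hvy
  have h2 : ∑ y ∈ S, (twoGraph G).degree y ≤ 2 * S.card := by
    refine sum_degree_le_of_forall_not_isCycle S (fun x hx y hxy => ?_) fun x hx w => ?_
    · obtain ⟨v, hv, hvx⟩ := (hmem x).1 hx
      exact (hmem y).2 ⟨v, hv, hvx.trans hxy.reachable⟩
    · obtain ⟨v, hv, hvx⟩ := (hmem x).1 hx
      exact hv.not_isCycle hG hvx w
  rw [Finset.sum_const, nsmul_eq_mul, mul_comm]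
  exact_mod_cast h1.trans h2

end Conflict

section Discharging

variable {V : Type*} [Fintype V] {G : SimpleGraph V}

/-- The charge sent along an edge from a vertex of degree `i` to a vertex of degree `j`. -/
def chargeSent (i j : ℕ) : ℤ :=
  if 3 ≤ i ∧ j = 2 then 2 else if i = 4 ∧ j = 3 then 1 else 0

lemma sum_neighborFinset_comm (f : V → V → ℤ) :
    ∑ w, ∑ x ∈ G.neighborFinset w, f w x = ∑ w, ∑ x ∈ G.neighborFinset w, f x w :=
  Finset.sum_comm' fun x y => by simp [G.adj_comm]

/-- The charge of `w` after discharging, starting from `5 deg w - 14`. -/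
noncomputable def finalCharge (G : SimpleGraph V) (w : V) : ℤ :=
  5 * G.degree w - 14 + ∑ x ∈ G.neighborFinset w,
    (chargeSent (G.degree x) (G.degree w) - chargeSent (G.degree w) (G.degree x))

lemma sum_finalCharge :
    ∑ w with 0 < G.degree w, finalCharge G w =
      ∑ w with 0 < G.degree w, (5 * G.degree w - 14 : ℤ) := by
  simp only [finalCharge, Finset.sum_add_distrib]
  rw [add_eq_left, Finset.sum_filter_of_ne fun w _ h => ?_]
  · simp only [Finset.sum_sub_distrib]
    rw [sum_neighborFinset_comm, sub_self]
  · contrapose! h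
    refine Finset.sum_eq_zero fun x hx => ?_
    rw [mem_neighborFinset] at hx
    exact absurd ((G.degree_pos_iff_exists_adj w).2 ⟨x, hx⟩) (by omega)

namespace IsInjCritical

variable {w : V}

lemma finalCharge_of_degree_eq_two (hG : IsInjCritical G) (hw : G.degree w = 2) :
    finalCharge G w = 0 := by
  rw [finalCharge, Finset.sum_congr rfl (g := fun _ => (2 : ℤ)), Finset.sum_const,
    card_neighborFinset_eq_degree, hw]
  · norm_num
  · intro x hx
    have := hG.three_le_degree ((mem_neighborFinset _ _ _).1 hx) hw
    simp [chargeSent, hw, this]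

lemma finalCharge_nonneg_of_degree_eq_three (hG : IsInjCritical G) (hw : G.degree w = 3) :
    0 ≤ finalCharge G w := by
  by_cases h : ∃ u, G.Adj u w ∧ G.degree u = 2
  · obtain ⟨u, huw, hu⟩ := h
    have h1 : (6 : ℤ) ≤ ∑ x ∈ G.neighborFinset w, ((G.degree x : ℤ) - 1) := by
      refine le_trans ?_ (Finset.sum_le_sum (f := fun x => ((G.degree x - 1 : ℕ) : ℤ)) ?_)
      · exact_mod_cast hG.six_le_sum_of_degree_eq_three huw hu hw
      · intro x hx
        have := hG.two_le_degree ((mem_neighborFinset _ _ _).1 hx).symm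
        omega
    have h2 : ∑ x ∈ G.neighborFinset w, (3 * ((G.degree x : ℤ) - 1) - 7) ≤
        ∑ x ∈ G.neighborFinset w,
          2 * (chargeSent (G.degree x) (G.degree w) - chargeSent (G.degree w) (G.degree x)) := by
      refine Finset.sum_le_sum fun x hx => ?_
      have h2 := hG.two_le_degree ((mem_neighborFinset _ _ _).1 hx).symm
      have h4 := hG.degree_le x
      rw [hw]
      interval_cases G.degree x <;> simp [chargeSent]
    rw [Finset.sum_sub_distrib, ← Finset.mul_sum, ← Finset.mul_sum, Finset.sum_const,
      card_neighborFinset_eq_degree, hw] at h2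
    rw [finalCharge, hw]
    rw [nsmul_eq_mul] at h2
    simp only [Nat.cast_ofNat] at h2 ⊢
    omega
  · push Not at h
    rw [finalCharge, hw]
    refine add_nonneg (by norm_num) (Finset.sum_nonneg fun x hx => ?_)
    have h2 := h x ((mem_neighborFinset _ _ _).1 hx).symm
    simp only [chargeSent, h2]
    split_ifs <;> simp_all

lemma finalCharge_of_degree_eq_four (hG : IsInjCritical G) (hw : G.degree w = 4) :
    finalCharge G w = 6 - ∑ x ∈ G.neighborFinset w, (4 - (G.degree x : ℤ)) := by
  have h : ∑ x ∈ G.neighborFinset w,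
      (chargeSent (G.degree x) 4 - chargeSent 4 (G.degree x)) =
        -∑ x ∈ G.neighborFinset w, (4 - (G.degree x : ℤ)) := by
    rw [← Finset.sum_neg_distrib]
    refine Finset.sum_congr rfl fun x hx => ?_
    have h2 := hG.two_le_degree ((mem_neighborFinset _ _ _).1 hx).symm
    have h4 := hG.degree_le x
    interval_cases G.degree x <;> simp [chargeSent]
  rw [finalCharge, hw, h, Nat.cast_ofNat]
  ring

lemma two_sub_twoDegree_le_finalCharge (hG : IsInjCritical G) (hw : G.degree w = 4) :
    2 - (twoDegree G w : ℤ) ≤ finalCharge G w := by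
  rw [hG.finalCharge_of_degree_eq_four hw]
  have h : ∑ x ∈ G.neighborFinset w, (4 - (G.degree x : ℤ)) ≤
      ∑ x ∈ G.neighborFinset w, (1 + if G.degree x = 2 then 1 else 0) := by
    refine Finset.sum_le_sum fun x hx => ?_
    have h2 := hG.two_le_degree ((mem_neighborFinset _ _ _).1 hx).symm
    split_ifs <;> omega
  rw [Finset.sum_add_distrib, Finset.sum_boole, Finset.sum_const, card_neighborFinset_eq_degree,
    hw] at h
  simp only [nsmul_eq_mul, mul_one, Nat.cast_ofNat] at h
  rw [twoDegree]
  omega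

lemma finalCharge_nonneg_of_degree_eq_four (hG : IsInjCritical G) (hw : G.degree w = 4)
    (hr : ¬ IsRich G w) : 0 ≤ finalCharge G w := by
  by_contra! h
  refine hr ⟨(conflictGraph_degree_le w).trans_lt ?_, ?_⟩
  · rw [hG.finalCharge_of_degree_eq_four hw] at h
    have h1 : ∑ x ∈ G.neighborFinset w, ((G.degree x - 1 : ℕ) : ℤ) =
        ∑ x ∈ G.neighborFinset w, (3 - (4 - (G.degree x : ℤ))) := by
      refine Finset.sum_congr rfl fun x hx => ?_
      have := hG.two_le_degree ((mem_neighborFinset _ _ _).1 hx).symm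
      omega
    rw [Finset.sum_sub_distrib, Finset.sum_const, card_neighborFinset_eq_degree, hw,
      ← Nat.cast_sum] at h1
    norm_num only [nsmul_eq_mul] at h1
    omega
  · have := hG.two_sub_twoDegree_le_finalCharge hw
    omega

theorem sum_charge_nonneg (hG : IsInjCritical G) :
    0 ≤ ∑ w with 0 < G.degree w, (5 * G.degree w - 14 : ℤ) := by
  rw [← sum_finalCharge]
  have hS := hG.sum_twoDegree_le
  set S : Finset V := {y | ∃ v, IsRich G v ∧ (twoGraph G).Reachable v y} with hS'
  have hmem : ∀ y, y ∈ S ↔ ∃ v, IsRich G v ∧ (twoGraph G).Reachable v y := by simp [hS']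
  have h4 : ∀ y ∈ S, G.degree y = 4 := fun y hy => by
    obtain ⟨v, hv, hvy⟩ := (hmem y).1 hy
    exact hv.degree_eq_four hG hvy
  have hsub : S ⊆ Finset.univ.filter fun w => 0 < G.degree w := fun y hy => by
    simp [h4 y hy]
  rw [← Finset.sum_sdiff hsub]
  refine add_nonneg (Finset.sum_nonneg fun w hw => ?_) ?_
  · simp only [Finset.mem_sdiff, Finset.mem_filter, Finset.mem_univ, true_and] at hw
    obtain ⟨x, hx⟩ := (G.degree_pos_iff_exists_adj w).1 hw.1
    have h2 := hG.two_le_degree hx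
    have h4 := hG.degree_le w
    obtain h | h | h : G.degree w = 2 ∨ G.degree w = 3 ∨ G.degree w = 4 := by omega
    · exact (hG.finalCharge_of_degree_eq_two h).ge
    · exact hG.finalCharge_nonneg_of_degree_eq_three h
    · exact hG.finalCharge_nonneg_of_degree_eq_four h fun hr =>
        hw.2 ((hmem w).2 ⟨w, hr, Reachable.refl w⟩)
  · refine le_trans ?_ (Finset.sum_le_sum fun y hy =>
      hG.two_sub_twoDegree_le_finalCharge (h4 y hy))
    rw [Finset.sum_sub_distrib]
    exact sub_nonneg.2 hS

end IsInjCritical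

lemma exists_isInjCritical_le (hΔ : ∀ v, G.degree v ≤ 4)
    (hG : ¬ (conflictGraph G).Colorable 6) : ∃ H ≤ G, IsInjCritical H := by
  obtain ⟨H, ⟨hHG, hH⟩, hmin⟩ := exists_minimal_of_wellFoundedLT
    (fun H => H ≤ G ∧ ¬ (conflictGraph H).Colorable 6) ⟨G, le_rfl, hG⟩
  refine ⟨H, hHG, fun v => (degree_le_of_le hHG).trans (hΔ v), hH, fun u v huv => ?_⟩
  by_contra hc
  have hle := hmin ⟨(deleteEdges_le _).trans hHG, hc⟩ (deleteEdges_le _) huv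
  simp at hle

lemma IsInjCritical.exists_adj (hG : IsInjCritical G) : ∃ u v, G.Adj u v := by
  by_contra! h
  exact hG.not_colorable ⟨Coloring.mk (fun _ => 0) fun ⟨_, w, huw, _⟩ => absurd huw (h _ _)⟩

/-- The density of a critical graph, spanned by its non-isolated vertices. -/
lemma IsInjCritical.seven_mul_card_support_le (hG : IsInjCritical G) :
    7 * G.support.ncard ≤ 5 * G.edgeSet.ncard := by
  have h1 := hG.sum_charge_nonneg
  have h2 : ∑ w with 0 < G.degree w, G.degree w = 2 * G.edgeSet.ncard := by
    rw [← coe_edgeFinset, Set.ncard_coe_finset, ← sum_degrees_eq_twice_card_edges]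
    exact Finset.sum_filter_of_ne fun w _ h => Nat.pos_of_ne_zero h
  have h3 : G.support.ncard = (Finset.univ.filter fun w => 0 < G.degree w).card := by
    rw [← Set.ncard_coe_finset]
    congr 1
    ext w
    simp only [mem_support, Finset.coe_filter, Finset.mem_univ, true_and, Set.mem_ofPred_eq,
      degree_pos_iff_exists_adj]
  rw [Finset.sum_sub_distrib, ← Finset.mul_sum, ← Nat.cast_sum, h2, Finset.sum_const, ← h3,
    nsmul_eq_mul] at h1
  push_cast at h1
  omega

end Discharging

end

/-- If `Δ(G) = 4` and `mad(G) < 14/5`, then `χᵢ(G) ≤ 6`. -/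
theorem injChromNum_le_six_of_maxDegree_eq_four {V : Type*} [Fintype V]
    (G : SimpleGraph V) [DecidableRel G.Adj]
    (hΔ : G.maxDegree = 4)
    (hmad : ∀ H : G.Subgraph, H.verts.Nonempty →
      (2 * H.edgeSet.ncard : ℚ) / H.verts.ncard < 14 / 5) :
    injChromNum G ≤ 6 := by
  suffices h : (conflictGraph G).Colorable 6 by
    obtain ⟨C⟩ := h
    exact Nat.sInf_le ⟨C, fun u v huv hw => C.valid ⟨huv, hw⟩⟩
  by_contra hG
  obtain ⟨H, hHG, hH⟩ := exists_isInjCritical_le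
    (fun v => by convert hΔ ▸ G.degree_le_maxDegree v) hG
  obtain ⟨u, v, huv⟩ := hH.exists_adj
  let H' : G.Subgraph :=
    { verts := H.support
      Adj := H.Adj
      adj_sub := fun h => hHG h
      edge_vert := fun h => ⟨_, h⟩
      symm := H.symm }
  have hlt := hmad H' ⟨u, v, huv⟩
  have hpos : (0 : ℚ) < H.support.ncard :=
    Nat.cast_pos.2 ((Set.ncard_pos (Set.toFinite _)).2 ⟨u, v, huv⟩)
  have hle : (7 * H.support.ncard : ℚ) ≤ 5 * H.edgeSet.ncard := by
    exact_mod_cast hH.seven_mul_card_support_le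
  rw [show H'.edgeSet = H.edgeSet from rfl, show H'.verts = H.support from rfl,
    div_lt_div_iff₀ hpos (by norm_num)] at hlt
  linarith
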